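/- arXiv:math/0411202 — 2 statements merged into one kernel-verified Lean document; each statement's English description precedes it below -/
import Mathlib

section
/- Let Π be a stochastic matrix on the index set I and π an invariant measure for Π. Then for all i, j ∈ I the family (π_k √(Π_{ki} Π_{kj}))_{k∈I} is summable, and its sum Q(π)_{ij} satisfies 0 ≤ Q(π)_{ij} ≤ √(π_i · π_j). -/
/-- Let `Pmat` be a stochastic matrix on `I` and `π` an invariant
measure for `Pmat`.  Then for all `i, j` the family `(π k · √(Pmat k i · Pmat k j))_k`
is summable, and its sum `Q(π)_{ij}` satisfies `0 ≤ Q(π)_{ij} ≤ √(π i · π j)`. -/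
theorem stmt12 (I : Type*)
    (Pmat : I → I → ℝ) (hnn : ∀ i j, 0 ≤ Pmat i j)
    (hrow : ∀ i, HasSum (fun j => Pmat i j) 1)
    (pi : I → ℝ) (hpinn : ∀ i, 0 ≤ pi i)
    (hinv : ∀ i, HasSum (fun k => pi k * Pmat k i) (pi i))
    (i j : I) :
    Summable (fun k => pi k * Real.sqrt (Pmat k i * Pmat k j)) ∧
    0 ≤ ∑' k, pi k * Real.sqrt (Pmat k i * Pmat k j) ∧
    ∑' k, pi k * Real.sqrt (Pmat k i * Pmat k j) ≤ Real.sqrt (pi i * pi j) := by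
  have hterm : ∀ k, 0 ≤ pi k * Real.sqrt (Pmat k i * Pmat k j) :=
    fun k => mul_nonneg (hpinn k) (Real.sqrt_nonneg _)
  have heq : ∀ k, pi k * Real.sqrt (Pmat k i * Pmat k j)
      = Real.sqrt (pi k * Pmat k i) * Real.sqrt (pi k * Pmat k j) := by
    intro k
    rw [Real.sqrt_mul (hnn k i), Real.sqrt_mul (hpinn k), Real.sqrt_mul (hpinn k)]
    nth_rewrite 1 [← Real.mul_self_sqrt (hpinn k)]
    ring
  have hn : ∀ a k, 0 ≤ pi k * Pmat k a := fun a k => mul_nonneg (hpinn k) (hnn k a)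
  have hbd : ∀ s : Finset I, ∑ k ∈ s, pi k * Real.sqrt (Pmat k i * Pmat k j)
      ≤ Real.sqrt (pi i * pi j) := by
    intro s
    rw [Finset.sum_congr rfl (fun k _ => heq k), Real.sqrt_mul (hpinn i)]
    refine (Real.sum_sqrt_mul_sqrt_le s (hn i) (hn j)).trans ?_
    exact mul_le_mul
      (Real.sqrt_le_sqrt (sum_le_hasSum s (fun k _ => hn i k) (hinv i)))
      (Real.sqrt_le_sqrt (sum_le_hasSum s (fun k _ => hn j k) (hinv j)))
      (Real.sqrt_nonneg _) (Real.sqrt_nonneg _)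
  exact ⟨summable_of_sum_le hterm hbd, tsum_nonneg hterm, Real.tsum_le_of_sum_le hterm hbd⟩
end

section
/- Let Π be a stochastic matrix on the index set I and π an invariant measure for Π. Then the matrix Q(π) is positive semidefinite as a kernel: for every finitely supported function c : I → ℂ, the sum ∑_{i,j} conj(c_i) · c_j · Q(π)_{ij} is a nonnegative real number. -/
open scoped ComplexOrder

/-- Let `Pmat` be a stochastic matrix on `I` and `π` an invariant
measure for `Pmat`.  Then the matrix `Q(π)_{ij} := ∑_k π k √(Pmat k i · Pmat k j)` is
positive semidefinite as a kernel: for every finitely supported `c : I → ℂ`, the sum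
`∑_{i,j} conj (c i) · c j · Q(π)_{ij}` is a nonnegative real number. -/
theorem stmt13 (I : Type*)
    (Pmat : I → I → ℝ) (hnn : ∀ i j, 0 ≤ Pmat i j)
    (hrow : ∀ i, HasSum (fun j => Pmat i j) 1)
    (pi : I → ℝ) (hpinn : ∀ i, 0 ≤ pi i)
    (hinv : ∀ i, HasSum (fun k => pi k * Pmat k i) (pi i))
    (c : I →₀ ℂ) :
    0 ≤ ∑ i ∈ c.support, ∑ j ∈ c.support,
      (starRingEnd ℂ) (c i) * c j *
        ((∑' k, pi k * Real.sqrt (Pmat k i * Pmat k j) : ℝ) : ℂ) := by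
  have hs : ∀ i j, Summable (fun k => pi k * Real.sqrt (Pmat k i * Pmat k j)) := by
    intro i j
    refine Summable.of_nonneg_of_le (fun k => mul_nonneg (hpinn k) (Real.sqrt_nonneg _)) ?_
      ((hinv i).summable.add (hinv j).summable)
    intro k
    rw [← mul_add]
    refine mul_le_mul_of_nonneg_left ?_ (hpinn k)
    rw [Real.sqrt_le_left (add_nonneg (hnn k i) (hnn k j))]
    nlinarith [hnn k i, hnn k j, mul_nonneg (hnn k i) (hnn k j),
      sq_nonneg (Pmat k i), sq_nonneg (Pmat k j)]
  have hS : HasSum (fun k => ∑ i ∈ c.support, ∑ j ∈ c.support,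
      (starRingEnd ℂ) (c i) * c j * ((pi k * Real.sqrt (Pmat k i * Pmat k j) : ℝ) : ℂ))
      (∑ i ∈ c.support, ∑ j ∈ c.support,
      (starRingEnd ℂ) (c i) * c j *
        ((∑' k, pi k * Real.sqrt (Pmat k i * Pmat k j) : ℝ) : ℂ)) := by
    refine hasSum_sum fun i _ => hasSum_sum fun j _ => HasSum.mul_left _ ?_
    exact Complex.hasSum_ofReal.mpr (hs i j).hasSum
  refine hS.nonneg fun k => ?_
  have key : ∑ i ∈ c.support, ∑ j ∈ c.support,
      (starRingEnd ℂ) (c i) * c j * ((pi k * Real.sqrt (Pmat k i * Pmat k j) : ℝ) : ℂ)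
      = (pi k : ℂ) * (star (∑ i ∈ c.support, c i * (Real.sqrt (Pmat k i) : ℂ)) *
        (∑ i ∈ c.support, c i * (Real.sqrt (Pmat k i) : ℂ))) := by
    rw [star_sum, Finset.sum_mul_sum, Finset.mul_sum]
    refine Finset.sum_congr rfl fun i _ => ?_
    rw [Finset.mul_sum]
    refine Finset.sum_congr rfl fun j _ => ?_
    rw [Real.sqrt_mul (hnn k i)]
    simp only [Complex.star_def, map_mul, Complex.conj_ofReal]
    push_cast
    ring
  rw [key]
  exact mul_nonneg (by exact_mod_cast hpinn k) (star_mul_self_nonneg _)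
end
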